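/- arXiv:1104.4008 — 4 statements merged into one kernel-verified Lean document; each statement's English description precedes it below -/
import Mathlib

section
/- Let r ≥ 1 be an integer and let A be a real positive definite symmetric r×r matrix. Then the system of equations 1 − Q_i = ∏_{j=1}^r Q_j^{A_{ij}} (i = 1,…,r) has exactly one solution (Q₁,…,Q_r) with Q_i ∈ (0,1) for all 1 ≤ i ≤ r. -/
open Filter Topology Matrix in
lemma nahm_coercive {r : ℕ} (A : Matrix (Fin r) (Fin r) ℝ) (hA : A.PosDef) :
    ∃ c : ℝ, 0 < c ∧ ∀ x : Fin r → ℝ, c * ‖x‖ ^ 2 ≤ x ⬝ᵥ (A *ᵥ x) := by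
  have hpos : ∀ x : Fin r → ℝ, x ≠ 0 → 0 < x ⬝ᵥ (A *ᵥ x) := by
    intro x hx
    simpa using hA.dotProduct_mulVec_pos hx
  have hcont : Continuous (fun x : Fin r → ℝ => x ⬝ᵥ (A *ᵥ x)) := by fun_prop
  have hc : ∃ c : ℝ, 0 < c ∧ ∀ x ∈ Metric.sphere (0 : Fin r → ℝ) 1, c ≤ x ⬝ᵥ (A *ᵥ x) := by
    rcases (Metric.sphere (0 : Fin r → ℝ) 1).eq_empty_or_nonempty with h | h
    · exact ⟨1, one_pos, by simp [h]⟩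
    · obtain ⟨y, hy, hmin⟩ := (isCompact_sphere (0 : Fin r → ℝ) 1).exists_isMinOn h
        hcont.continuousOn
      refine ⟨_, hpos y ?_, fun x hx => hmin hx⟩
      rintro rfl
      simp at hy
  obtain ⟨c, hc0, hc⟩ := hc
  refine ⟨c, hc0, fun x => ?_⟩
  by_cases hx : x = 0
  · simp [hx]
  have hn : 0 < ‖x‖ := norm_pos_iff.mpr hx
  have h1 := hc (‖x‖⁻¹ • x) (by simp [norm_smul, hn.ne'])
  rw [Matrix.mulVec_smul, dotProduct_smul, smul_dotProduct, smul_eq_mul, smul_eq_mul] at h1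
  calc c * ‖x‖ ^ 2 ≤ (‖x‖⁻¹ * (‖x‖⁻¹ * (x ⬝ᵥ (A *ᵥ x)))) * ‖x‖ ^ 2 := by gcongr
    _ = _ := by field_simp

open Filter Topology Matrix in
lemma nahm_min {r : ℕ} (A : Matrix (Fin r) (Fin r) ℝ) (hA : A.PosDef) (hAs : A.IsSymm)
    (h : ℝ → ℝ) (hh : Continuous h) (K : ℝ) (hK : ∀ x, |h x| ≤ K) :
    ∃ u : Fin r → ℝ, ∀ i, (A *ᵥ u) i = h (u i) := by
  obtain ⟨c, hc0, hc⟩ := nahm_coercive A hA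
  obtain ⟨G, hG, hGb⟩ : ∃ G : ℝ → ℝ, (∀ x, HasDerivAt G (h x) x) ∧ ∀ x, |G x| ≤ K * |x| := by
    refine ⟨fun x => ∫ t in (0:ℝ)..x, h t, fun x => ?_, fun x => ?_⟩
    · exact intervalIntegral.integral_hasDerivAt_right (hh.intervalIntegrable _ _)
        (hh.stronglyMeasurableAtFilter _ _) hh.continuousAt
    · have := intervalIntegral.norm_integral_le_of_norm_le_const (a := 0) (b := x) (f := h)
        (C := K) (fun t _ => hK t)
      simpa using this
  have hK0 : 0 ≤ K := (abs_nonneg _).trans (hK 0)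
  have hGc : Continuous G := continuous_iff_continuousAt.mpr fun x => (hG x).continuousAt
  set F : (Fin r → ℝ) → ℝ := fun u => (1/2) * (u ⬝ᵥ (A *ᵥ u)) - ∑ j, G (u j) with hF
  have hFc : Continuous F := by
    rw [hF]; fun_prop
  have hlow : ∀ u, ‖u‖ * (c / 2 * ‖u‖ - r * K) ≤ F u := by
    intro u
    have h1 : ∑ j, G (u j) ≤ ∑ j : Fin r, K * ‖u‖ := by
      refine Finset.sum_le_sum fun j _ => (le_abs_self _).trans ((hGb _).trans ?_)
      gcongr
      exact norm_le_pi_norm u j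
    simp only [Finset.sum_const, Finset.card_univ, Fintype.card_fin, nsmul_eq_mul] at h1
    have h2 := hc u
    simp only [hF]
    nlinarith
  have htend : Tendsto F (cocompact _) atTop := by
    refine tendsto_atTop_mono hlow ?_
    have hn := tendsto_norm_cocompact_atTop (E := Fin r → ℝ)
    refine hn.atTop_mul_atTop₀ ?_
    exact tendsto_atTop_add_const_right _ _ (hn.const_mul_atTop (by positivity))
  obtain ⟨u, hu⟩ := hFc.exists_forall_le htend
  refine ⟨u, fun i => ?_⟩
  have hexp : ∀ t : ℝ, F (u + Pi.single i t) =
      (1/2) * (u ⬝ᵥ (A *ᵥ u)) + t * (A *ᵥ u) i + t ^ 2 * (A i i / 2)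
        - ∑ j, G (u j + (Pi.single i t : Fin r → ℝ) j) := by
    intro t
    have hsym : u ⬝ᵥ (A *ᵥ Pi.single i t) = t * (A *ᵥ u) i := by
      rw [Matrix.dotProduct_mulVec, dotProduct_single, ← Matrix.mulVec_transpose, hAs.eq, mul_comm]
    have h2 : (A *ᵥ Pi.single i t) i = A i i * t := by
      simp [Matrix.mulVec, dotProduct_single]
    simp only [hF, Matrix.mulVec_add, add_dotProduct, dotProduct_add, hsym, single_dotProduct, h2,
      Pi.add_apply]
    ring
  have hder : HasDerivAt (fun t : ℝ => F (u + Pi.single i t)) ((A *ᵥ u) i - h (u i)) 0 := by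
    simp only [hexp]
    have hs : HasDerivAt (fun t : ℝ => ∑ j, G (u j + (Pi.single i t : Fin r → ℝ) j))
        (∑ j, if j = i then h (u i) else 0) 0 := by
      refine HasDerivAt.fun_sum fun j _ => ?_
      by_cases hj : j = i
      · subst hj
        simp only [Pi.single_eq_same, if_true]
        have := HasDerivAt.comp_const_add (u j) 0 (f := G) (f' := h (u j)) (by simpa using hG (u j))
        exact this
      · simp only [Pi.single_eq_of_ne hj, hj, if_false]
        exact hasDerivAt_const _ _
    have hp : HasDerivAt (fun t : ℝ => (1/2) * (u ⬝ᵥ (A *ᵥ u)) + t * (A *ᵥ u) i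
        + t ^ 2 * (A i i / 2)) ((A *ᵥ u) i) 0 := by
      have := (((hasDerivAt_id (0:ℝ)).mul_const ((A *ᵥ u) i)).const_add
        ((1/2) * (u ⬝ᵥ (A *ᵥ u)))).add (((hasDerivAt_id (0:ℝ)).pow 2).mul_const (A i i / 2))
      exact this.congr_deriv (by simp)
    exact (hp.sub hs).congr_deriv (by simp)
  have hmin : IsLocalMin (fun t : ℝ => F (u + Pi.single i t)) 0 := by
    refine Eventually.of_forall fun t => ?_
    simpa using hu (u + Pi.single i t)
  have := hmin.hasDerivAt_eq_zero hder
  linarith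

/-- the function `-log (1 - exp (-x))` -/
noncomputable def nahmG (x : ℝ) : ℝ := -Real.log (1 - Real.exp (-x))

lemma nahmG_sub_pos {x : ℝ} (hx : 0 < x) : 0 < 1 - Real.exp (-x) := by
  have : Real.exp (-x) < 1 := Real.exp_lt_one_iff.mpr (by linarith)
  linarith

lemma nahmG_exp {x : ℝ} (hx : 0 < x) : Real.exp (-nahmG x) = 1 - Real.exp (-x) := by
  rw [nahmG, neg_neg, Real.exp_log (nahmG_sub_pos hx)]

lemma nahmG_pos {x : ℝ} (hx : 0 < x) : 0 < nahmG x := by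
  have := Real.log_neg (nahmG_sub_pos hx) (by linarith [Real.exp_pos (-x)])
  rw [nahmG]; linarith

lemma nahmG_invol {x : ℝ} (hx : 0 < x) : nahmG (nahmG x) = x := by
  rw [nahmG, nahmG_exp hx]; simp

lemma nahmG_anti {x y : ℝ} (hx : 0 < x) (hxy : x ≤ y) : nahmG y ≤ nahmG x := by
  unfold nahmG
  have := Real.log_le_log (nahmG_sub_pos hx)
    (by gcongr : 1 - Real.exp (-x) ≤ 1 - Real.exp (-y))
  linarith

lemma nahmG_le {x : ℝ} (hx : 0 < x) : x * nahmG x ≤ 1 := by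
  have h0 := nahmG_pos hx
  have h1 := Real.add_one_le_exp (nahmG x)
  have h2 := nahmG_exp hx
  have h3 := Real.add_one_le_exp x
  rw [Real.exp_neg] at h2
  rw [Real.exp_neg] at h2
  have he := Real.exp_pos x
  have hf := Real.exp_pos (nahmG x)
  have h4 : (Real.exp x - 1) * (Real.exp (nahmG x) - 1) = 1 := by
    field_simp at h2
    nlinarith
  nlinarith [mul_le_mul (by linarith : x ≤ Real.exp x - 1)
    (by linarith : nahmG x ≤ Real.exp (nahmG x) - 1) h0.le (by linarith)]

open Matrix in
lemma nahm_exists {r : ℕ} (A : Matrix (Fin r) (Fin r) ℝ) (hA : A.PosDef) (hAs : A.IsSymm) :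
    ∃ u : Fin r → ℝ, (∀ i, 0 < u i) ∧ ∀ i, (A *ᵥ u) i = nahmG (u i) := by
  obtain ⟨c, hc0, hc⟩ := nahm_coercive A hA
  set S : ℝ := ∑ i, ∑ j, |A i j| with hS
  have hS0 : 0 ≤ S := by positivity
  set B : ℝ := S * (1 + r / c) with hB
  have hB0 : 0 ≤ B := by positivity
  set δ : ℝ := nahmG (B + 1) with hδ
  have hδ0 : 0 < δ := nahmG_pos (by linarith)
  have hgδ : nahmG δ = B + 1 := nahmG_invol (by linarith)
  have hm : ∀ x : ℝ, 0 < max x δ := fun x => lt_max_of_lt_right hδ0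
  have hcont : Continuous (fun x : ℝ => nahmG (max x δ)) := by
    unfold nahmG
    refine (Continuous.log (by fun_prop) fun x => (nahmG_sub_pos (hm x)).ne').neg
  obtain ⟨u, hu⟩ := nahm_min A hA hAs (fun x => nahmG (max x δ)) hcont (B + 1) (by
    intro x
    rw [abs_of_pos (nahmG_pos (hm x)), ← hgδ]
    exact nahmG_anti hδ0 (le_max_right _ _))
  have h1 : u ⬝ᵥ (A *ᵥ u) ≤ r := by
    have : ∑ i, u i * (A *ᵥ u) i ≤ ∑ i : Fin r, (1 : ℝ) := by
      refine Finset.sum_le_sum fun i _ => ?_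
      rw [hu i]
      have hp := nahmG_pos (hm (u i))
      calc u i * nahmG (max (u i) δ) ≤ max (u i) δ * nahmG (max (u i) δ) := by
            gcongr; exact le_max_left _ _
        _ ≤ 1 := nahmG_le (hm _)
    simpa [dotProduct] using this
  have h2 : ‖u‖ ≤ 1 + r / c := by
    have h3 : ‖u‖ ^ 2 ≤ r / c := by
      rw [le_div_iff₀ hc0]
      linarith [hc u]
    nlinarith [sq_nonneg (‖u‖ - 1)]
  have h3 : ∀ i, (A *ᵥ u) i ≤ B := by
    intro i
    calc (A *ᵥ u) i = ∑ j, A i j * u j := rfl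
      _ ≤ ∑ j, |A i j| * ‖u‖ := by
        refine Finset.sum_le_sum fun j _ => (le_abs_self _).trans ?_
        rw [abs_mul]
        gcongr
        exact norm_le_pi_norm u j
      _ = (∑ j, |A i j|) * ‖u‖ := by rw [Finset.sum_mul]
      _ ≤ S * (1 + r / c) := by
        gcongr
        exact Finset.single_le_sum (f := fun i => ∑ j, |A i j|)
          (fun i _ => by positivity) (Finset.mem_univ i)
  have h4 : ∀ i, δ < u i := by
    intro i
    by_contra! hle
    have h5 := hu i
    simp only [max_eq_right hle, hgδ] at h5
    linarith [h3 i]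
  refine ⟨u, fun i => hδ0.trans (h4 i), fun i => ?_⟩
  rw [hu i, max_eq_left (h4 i).le]

open Matrix in
lemma nahm_iff {r : ℕ} (A : Matrix (Fin r) (Fin r) ℝ) (u : Fin r → ℝ) (hu : ∀ i, 0 < u i) (i : Fin r) :
    1 - Real.exp (-u i) = ∏ j, (Real.exp (-u j)) ^ (A i j) ↔ (A *ᵥ u) i = nahmG (u i) := by
  have : ∏ j, (Real.exp (-u j)) ^ (A i j) = Real.exp (-(A *ᵥ u) i) := by
    simp only [← Real.exp_mul, ← Real.exp_sum, Matrix.mulVec, dotProduct, ← Finset.sum_neg_distrib]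
    congr 1
    exact Finset.sum_congr rfl fun j _ => by ring
  rw [this, ← nahmG_exp (hu i), Real.exp_eq_exp, neg_inj, eq_comm]

open Matrix in
lemma nahm_unique {r : ℕ} (A : Matrix (Fin r) (Fin r) ℝ) (hA : A.PosDef) (u v : Fin r → ℝ)
    (hu : ∀ i, 0 < u i) (hv : ∀ i, 0 < v i) (h1 : ∀ i, (A *ᵥ u) i = nahmG (u i))
    (h2 : ∀ i, (A *ᵥ v) i = nahmG (v i)) : u = v := by
  by_contra hne
  have h3 : 0 < (u - v) ⬝ᵥ (A *ᵥ (u - v)) := by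
    simpa using hA.dotProduct_mulVec_pos (sub_ne_zero.mpr hne)
  have h4 : (u - v) ⬝ᵥ (A *ᵥ (u - v)) ≤ 0 := by
    refine Finset.sum_nonpos fun i _ => ?_
    rw [Matrix.mulVec_sub, Pi.sub_apply, Pi.sub_apply, h1, h2]
    rcases le_total (u i) (v i) with h | h
    · exact mul_nonpos_of_nonpos_of_nonneg (by linarith) (by linarith [nahmG_anti (hu i) h])
    · exact mul_nonpos_of_nonneg_of_nonpos (by linarith) (by linarith [nahmG_anti (hv i) h])
  linarith

/-- Let `r ≥ 1` and let `A` be a real positive definite symmetric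
`r × r` matrix. Then the Nahm system `1 - Q i = ∏ j, (Q j) ^ (A i j)` (real powers)
has exactly one solution with all `Q i ∈ (0, 1)`. -/
theorem nahm_system_exists_unique_solution {r : ℕ} (hr : 1 ≤ r)
    (A : Matrix (Fin r) (Fin r) ℝ) (hA : A.PosDef) (hAs : A.IsSymm) :
    ∃! Q : Fin r → ℝ,
      (∀ i, Q i ∈ Set.Ioo (0 : ℝ) 1) ∧
      (∀ i, 1 - Q i = ∏ j, (Q j) ^ (A i j)) := by
  obtain ⟨u, hu, hAu⟩ := nahm_exists A hA hAs
  refine ⟨fun i => Real.exp (-u i), ⟨fun i => ⟨Real.exp_pos _, ?_⟩, fun i => ?_⟩, ?_⟩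
  · exact Real.exp_lt_one_iff.mpr (by linarith [hu i])
  · exact (nahm_iff A u hu i).mpr (hAu i)
  · rintro Q ⟨hQ, hQe⟩
    obtain ⟨v, rfl⟩ : ∃ v : Fin r → ℝ, Q = fun i => Real.exp (-v i) :=
      ⟨fun i => -Real.log (Q i), by funext i; simp [Real.exp_log (hQ i).1]⟩
    have hv : ∀ i, 0 < v i := fun i => by
      have := (hQ i).2
      rw [Real.exp_lt_one_iff] at this
      linarith
    rw [nahm_unique A hA v u hv hu (fun i => (nahm_iff A v hv i).mp (hQe i)) hAu]
end

section
/- Let r ≥ 1 be an integer and let A be a real positive definite symmetric r×r matrix. Define f_A : (0,∞)^r → ℝ by f_A(x) = (1/2) xᵀAx + ∑_{i=1}^r Li₂(exp(−x_i)). Then f_A is strictly convex on (0,∞)^r, attains its global infimum over (0,∞)^r at some interior point, and has exactly one critical point in (0,∞)^r. -/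
/-- The dilogarithm `Li₂(x) = ∑_{k ≥ 1} x^k / k²`. -/
noncomputable def dilog (x : ℝ) : ℝ := ∑' k : ℕ, x ^ (k + 1) / ((k : ℝ) + 1) ^ 2

open Filter Topology Set

noncomputable def gdil (t : ℝ) : ℝ := dilog (Real.exp (-t))

theorem gdil_summable_u : Summable (fun k : ℕ => 1 / ((k : ℝ) + 1) ^ 2) := by
  have h := (summable_nat_add_iff 1).2 (Real.summable_one_div_nat_pow.2 (by norm_num : 1 < 2))
  simpa using h

theorem gdil_eq (t : ℝ) : gdil t = ∑' k : ℕ, Real.exp (-(((k : ℝ) + 1) * t)) / ((k : ℝ) + 1) ^ 2 := by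
  unfold gdil dilog
  congr 1; ext k
  rw [← Real.exp_nat_mul]; push_cast; congr 2; ring

theorem gdil_bound (k : ℕ) (t : ℝ) (ht : 0 ≤ t) :
    Real.exp (-(((k : ℝ) + 1) * t)) / ((k : ℝ) + 1) ^ 2 ≤ 1 / ((k : ℝ) + 1) ^ 2 := by
  gcongr
  rw [Real.exp_le_one_iff]
  have : 0 ≤ ((k : ℝ) + 1) * t := by positivity
  linarith

theorem gdil_summable (t : ℝ) (ht : 0 ≤ t) :
    Summable (fun k : ℕ => Real.exp (-(((k : ℝ) + 1) * t)) / ((k : ℝ) + 1) ^ 2) :=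
  Summable.of_nonneg_of_le (fun k => by positivity) (fun k => gdil_bound k t ht) gdil_summable_u

theorem gdil_nonneg (t : ℝ) : 0 ≤ gdil t := by
  rw [gdil_eq]; exact tsum_nonneg fun k => by positivity

theorem gdil_cont : ContinuousOn gdil (Ici 0) := by
  have : gdil = fun t => ∑' k : ℕ, Real.exp (-(((k : ℝ) + 1) * t)) / ((k : ℝ) + 1) ^ 2 :=
    funext gdil_eq
  rw [this]
  refine continuousOn_tsum (fun k => by fun_prop) gdil_summable_u fun k x hx => ?_
  rw [Real.norm_of_nonneg (by positivity)]
  exact gdil_bound k x hx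

theorem gdil_convex : ConvexOn ℝ (Ici 0) gdil := by
  refine ⟨convex_Ici 0, fun x hx y hy a b ha hb hab => ?_⟩
  have hz : 0 ≤ a • x + b • y := (convex_Ici (0:ℝ)) hx hy ha hb hab
  rw [gdil_eq, gdil_eq x, gdil_eq y, smul_eq_mul (a := a) (b := ∑' k : ℕ, _),
    smul_eq_mul (a := b) (b := ∑' k : ℕ, _), ← tsum_mul_left, ← tsum_mul_left,
    ← ((gdil_summable x hx).mul_left a).tsum_add ((gdil_summable y hy).mul_left b)]
  refine (gdil_summable _ hz).tsum_le_tsum (fun k => ?_)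
    (((gdil_summable x hx).mul_left a).add ((gdil_summable y hy).mul_left b))
  have h := convexOn_exp.2 (mem_univ (-(((k : ℝ) + 1) * x))) (mem_univ (-(((k : ℝ) + 1) * y)))
    ha hb hab
  simp only [smul_eq_mul] at h ⊢
  rw [← mul_div_assoc, ← mul_div_assoc, ← add_div]
  refine div_le_div_of_nonneg_right (le_trans (le_of_eq ?_) h) (by positivity)
  congr 1; ring

theorem gdil_diff (t : ℝ) (ht : 0 < t) : DifferentiableAt ℝ gdil t := by
  have e : gdil = fun t => ∑' k : ℕ, Real.exp (-(((k : ℝ) + 1) * t)) / ((k : ℝ) + 1) ^ 2 :=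
    funext gdil_eq
  rw [e]
  have hu : Summable (fun k : ℕ => Real.exp (-(t/2)) ^ (k + 1)) := by
    refine (summable_nat_add_iff 1).2 (summable_geometric_of_lt_one (Real.exp_pos _).le ?_)
    rw [Real.exp_lt_one_iff]; linarith
  refine (hasDerivAt_tsum_of_isPreconnected (t := Ioi (t/2)) (y₀ := t) (y := t)
    (g := fun (k : ℕ) y => Real.exp (-(((k : ℝ) + 1) * y)) / ((k : ℝ) + 1) ^ 2)
    (g' := fun (k : ℕ) y => Real.exp (-(((k : ℝ) + 1) * y)) * (-((k:ℝ) + 1)) / ((k : ℝ) + 1) ^ 2) 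
    hu isOpen_Ioi
    isPreconnected_Ioi ?_ ?_ (by simpa using ht) (gdil_summable t ht.le)
    (by simpa using ht)).differentiableAt
  · intro k y hy
    have h1 : HasDerivAt (fun y : ℝ => -(((k : ℝ) + 1) * y)) (-((k:ℝ) + 1)) y := by
      simpa using ((hasDerivAt_id' y).const_mul ((k:ℝ)+1)).fun_neg
    exact h1.exp.div_const _
  · intro k y hy
    have hk : (1:ℝ) ≤ (k:ℝ) + 1 := by simp
    rw [← Real.exp_nat_mul, norm_div, norm_mul, norm_neg, Real.norm_of_nonneg (Real.exp_pos _).le,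
      Real.norm_of_nonneg (by positivity : 0 ≤ (k:ℝ)+1), Real.norm_of_nonneg (by positivity),
      div_le_iff₀ (by positivity)]
    have : Real.exp (-(((k : ℝ) + 1) * y)) ≤ Real.exp (((k + 1 : ℕ) : ℝ) * -(t/2)) := by
      rw [Real.exp_le_exp]; push_cast
      have : t / 2 < y := hy
      nlinarith
    have h2 : (k:ℝ) + 1 ≤ ((k:ℝ)+1)^2 := by nlinarith
    gcongr

theorem gdil_sub (N : ℕ) (t : ℝ) (ht : 0 ≤ t) :
    gdil t - gdil 0 ≤
      ∑ k ∈ Finset.range N, (Real.exp (-(((k : ℝ) + 1) * t)) - 1) / ((k : ℝ) + 1) ^ 2 := by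
  have h := (gdil_summable 0 le_rfl).sub (gdil_summable t ht)
  have h2 := h.sum_le_tsum (Finset.range N) (fun k _ => by
    have := gdil_bound k t ht
    simpa using this)
  rw [(gdil_summable 0 le_rfl).tsum_sub (gdil_summable t ht), ← gdil_eq, ← gdil_eq] at h2
  have h3 : ∑ k ∈ Finset.range N, (Real.exp (-(((k : ℝ) + 1) * t)) - 1) / ((k : ℝ) + 1) ^ 2
    = - ∑ k ∈ Finset.range N, (Real.exp (-(((k : ℝ) + 1) * 0)) / ((k : ℝ) + 1) ^ 2 - 
      Real.exp (-(((k : ℝ) + 1) * t)) / ((k : ℝ) + 1) ^ 2) := by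
    rw [← Finset.sum_neg_distrib]
    refine Finset.sum_congr rfl fun k _ => ?_
    simp; ring
  rw [h3]; linarith

/-- the key slope estimate: no linear lower bound at zero -/
theorem gdil_steep (a b : ℝ) (h : ∀ t : ℝ, 0 ≤ t → 0 ≤ t * a + t ^ 2 * b + (gdil t - gdil 0)) :
    False := by
  have key : ∀ N : ℕ, ∑ k ∈ Finset.range N, 1 / ((k : ℝ) + 1) ≤ a := by
    intro N
    let F : ℝ → ℝ := fun t => t * a + t ^ 2 * b +
      ∑ k ∈ Finset.range N, (Real.exp (-(((k : ℝ) + 1) * t)) - 1) / ((k : ℝ) + 1) ^ 2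
    have hF : HasDerivAt F (a - ∑ k ∈ Finset.range N, 1 / ((k : ℝ) + 1)) 0 := by
      have h1 : HasDerivAt (fun t : ℝ => t * a + t ^ 2 * b) a 0 := by
        simpa using ((hasDerivAt_id' (0:ℝ)).mul_const a).fun_add (((hasDerivAt_id' (0:ℝ)).fun_pow 2).mul_const b)
      have h2 : HasDerivAt (fun t : ℝ => ∑ k ∈ Finset.range N,
          (Real.exp (-(((k : ℝ) + 1) * t)) - 1) / ((k : ℝ) + 1) ^ 2)
          (∑ k ∈ Finset.range N, -(1 / ((k : ℝ) + 1))) 0 := by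
        refine HasDerivAt.fun_sum fun k _ => ?_
        have h1 : HasDerivAt (fun y : ℝ => -(((k : ℝ) + 1) * y)) (-((k:ℝ) + 1)) 0 := by
          simpa using ((hasDerivAt_id' (0:ℝ)).const_mul ((k:ℝ)+1)).fun_neg
        refine ((h1.exp.sub_const 1).div_const (((k:ℝ)+1)^2)).congr_deriv ?_
        have : (k:ℝ) + 1 ≠ 0 := by positivity
        simp only [mul_zero, neg_zero, Real.exp_zero]; field_simp
      rw [Finset.sum_neg_distrib] at h2
      exact h1.add h2
    have hs := hF.hasDerivWithinAt (s := Ioi 0)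
    rw [hasDerivWithinAt_iff_tendsto_slope' (by simp)] at hs
    have : 0 ≤ a - ∑ k ∈ Finset.range N, 1 / ((k : ℝ) + 1) := by
      refine ge_of_tendsto hs ?_
      filter_upwards [self_mem_nhdsWithin] with t ht
      have ht : 0 < t := ht
      have hF0 : F 0 = 0 := by simp [F]
      rw [slope_def_field, hF0]
      have := h t ht.le
      have := gdil_sub N t ht.le
      refine div_nonneg ?_ (by linarith)
      simp only [F]; linarith
    linarith
  obtain ⟨N, hN⟩ := (Real.tendsto_sum_range_one_div_nat_succ_atTop.eventually_gt_atTop a).exists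
  exact absurd (key N) (not_le.2 hN)

theorem crit_isMin {E : Type*} [NormedAddCommGroup E] [NormedSpace ℝ E] {s : Set E} {f : E → ℝ}
    (hc : ConvexOn ℝ s f) {x : E} (hx : x ∈ s) (hd : DifferentiableAt ℝ f x)
    (h0 : fderiv ℝ f x = 0) : ∀ y ∈ s, f x ≤ f y := by
  intro y hy
  have hc1 := hc.comp_affineMap (AffineMap.lineMap x y : ℝ →ᵃ[ℝ] E)
  have hd1 : HasDerivAt (f ∘ (AffineMap.lineMap x y : ℝ →ᵃ[ℝ] E)) 0 0 := by
    have h1 : HasFDerivAt f (0 : E →L[ℝ] ℝ) ((AffineMap.lineMap x y : ℝ →ᵃ[ℝ] E) 0) := by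
      simpa [← h0] using hd.hasFDerivAt
    simpa using h1.comp_hasDerivAt (0:ℝ) (AffineMap.hasDerivAt_lineMap (a := x) (b := y))
  have := hc1.le_slope_of_hasDerivAt (x := 0) (y := 1) (by simpa using hx) (by simpa using hy)
    one_pos hd1
  simpa [slope_def_field] using this

noncomputable def qf {r : ℕ} (A : Matrix (Fin r) (Fin r) ℝ) (x : Fin r → ℝ) : ℝ :=
  ∑ i, ∑ j, x i * A i j * x j

theorem qf_eq {r : ℕ} (A : Matrix (Fin r) (Fin r) ℝ) (x : Fin r → ℝ) :
    qf A x = x ⬝ᵥ (A.mulVec x) := by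
  simp [qf, dotProduct, Matrix.mulVec, Finset.mul_sum, mul_assoc]

theorem qf_pos {r : ℕ} (A : Matrix (Fin r) (Fin r) ℝ) (hA : A.PosDef) (x : Fin r → ℝ)
    (hx : x ≠ 0) : 0 < qf A x := by
  rw [qf_eq]; simpa using hA.dotProduct_mulVec_pos hx

theorem qf_comb {r : ℕ} (A : Matrix (Fin r) (Fin r) ℝ) (x y : Fin r → ℝ) (a b : ℝ)
    (hab : a + b = 1) :
    qf A (a • x + b • y) = a * qf A x + b * qf A y - a * b * qf A (x - y) := by
  obtain rfl : b = 1 - a := by linarith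
  simp only [qf_eq, Matrix.mulVec_add, Matrix.mulVec_sub, Matrix.mulVec_smul, dotProduct_add,
    add_dotProduct, dotProduct_sub, sub_dotProduct, smul_dotProduct, dotProduct_smul, smul_eq_mul]
  ring

theorem qf_strict {r : ℕ} (A : Matrix (Fin r) (Fin r) ℝ) (hA : A.PosDef) (s : Set (Fin r → ℝ))
    (hs : Convex ℝ s) : StrictConvexOn ℝ s (fun x => (1/2) * qf A x) := by
  refine ⟨hs, fun x _ y _ hxy a b ha hb hab => ?_⟩
  have := qf_pos A hA (x - y) (sub_ne_zero.2 hxy)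
  have h2 : 0 < a * b * qf A (x - y) := by positivity
  simp only [smul_eq_mul, qf_comb A x y a b hab]
  linarith

theorem qf_cont {r : ℕ} (A : Matrix (Fin r) (Fin r) ℝ) : Continuous (qf A) := by
  unfold qf; fun_prop

theorem qf_coercive {r : ℕ} (hr : 1 ≤ r) (A : Matrix (Fin r) (Fin r) ℝ) (hA : A.PosDef) :
    ∃ c > 0, ∀ x, c * ‖x‖ ^ 2 ≤ qf A x := by
  have : Nonempty (Fin r) := ⟨⟨0, hr⟩⟩
  obtain ⟨z, hz, hm⟩ := (isCompact_sphere (0 : Fin r → ℝ) 1).exists_isMinOn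
    (NormedSpace.sphere_nonempty.2 zero_le_one) (qf_cont A).continuousOn
  have hz0 : z ≠ 0 := by rintro rfl; simp at hz
  refine ⟨qf A z, qf_pos A hA z hz0, fun x => ?_⟩
  by_cases hx : x = 0
  · simp [hx, qf]
  have hn : 0 < ‖x‖ := norm_pos_iff.2 hx
  have h1 : qf A z ≤ qf A (‖x‖⁻¹ • x) := hm (by
    simp [norm_smul, hn.ne'])
  have h2 : qf A (‖x‖⁻¹ • x) = qf A x / ‖x‖ ^ 2 := by
    simp only [qf_eq, Matrix.mulVec_smul, smul_dotProduct, dotProduct_smul, smul_eq_mul]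
    field_simp
  rw [h2, le_div_iff₀ (by positivity)] at h1
  exact h1

theorem qf_single {r : ℕ} (A : Matrix (Fin r) (Fin r) ℝ) (x e : Fin r → ℝ) (t : ℝ) :
    qf A (x + t • e) = qf A x + t * (x ⬝ᵥ A.mulVec e + e ⬝ᵥ A.mulVec x) + t ^ 2 * qf A e := by
  simp only [qf_eq, Matrix.mulVec_add, Matrix.mulVec_smul, dotProduct_add,
    add_dotProduct, smul_dotProduct, dotProduct_smul, smul_eq_mul]
  ring

theorem nahm_potential_strictly_convex_min_unique_critical {r : ℕ} (hr : 1 ≤ r)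
    (A : Matrix (Fin r) (Fin r) ℝ) (hA : A.PosDef) (hAs : A.IsSymm)
    (f : (Fin r → ℝ) → ℝ)
    (hf : f = fun x => (1 / 2) * (∑ i, ∑ j, x i * A i j * x j) +
      ∑ i, dilog (Real.exp (-x i))) :
    StrictConvexOn ℝ {x : Fin r → ℝ | ∀ i, 0 < x i} f ∧
    (∃ x : Fin r → ℝ, (∀ i, 0 < x i) ∧ ∀ y : Fin r → ℝ, (∀ i, 0 < y i) → f x ≤ f y) ∧
    (∃! x : Fin r → ℝ, (∀ i, 0 < x i) ∧ fderiv ℝ f x = 0) := by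
  replace hf : f = fun x => (1 / 2) * qf A x + ∑ i, gdil (x i) := hf
  have hSc : Convex ℝ {x : Fin r → ℝ | ∀ i, 0 < x i} := by
    have : {x : Fin r → ℝ | ∀ i, 0 < x i} = Set.pi univ (fun _ => Ioi (0:ℝ)) := by
      ext x; simp
    rw [this]; exact convex_pi fun i _ => convex_Ioi 0
  have hSo : IsOpen {x : Fin r → ℝ | ∀ i, 0 < x i} := by
    have : {x : Fin r → ℝ | ∀ i, 0 < x i} = Set.pi univ (fun _ => Ioi (0:ℝ)) := by
      ext x; simp
    rw [this]; exact isOpen_set_pi finite_univ fun i _ => isOpen_Ioi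
  have hgc : ConvexOn ℝ {x : Fin r → ℝ | ∀ i, 0 < x i} (fun x => ∑ i, gdil (x i)) := by
    refine ⟨hSc, fun x hx y hy a b ha hb hab => ?_⟩
    simp only [smul_eq_mul, Finset.mul_sum]
    rw [← Finset.sum_add_distrib]
    exact Finset.sum_le_sum fun i _ => gdil_convex.2 (hx i).le (hy i).le ha hb hab
  have hconv : StrictConvexOn ℝ {x : Fin r → ℝ | ∀ i, 0 < x i} f := by
    rw [hf]; exact (qf_strict A hA _ hSc).add_convexOn hgc
  have hmin : ∃ x : Fin r → ℝ, (∀ i, 0 < x i) ∧ ∀ y : Fin r → ℝ, (∀ i, 0 < y i) → f x ≤ f y := by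
    obtain ⟨c, hc, hq⟩ := qf_coercive hr A hA
    have hcl : IsClosed {x : Fin r → ℝ | ∀ i, 0 ≤ x i} := by
      have : {x : Fin r → ℝ | ∀ i, 0 ≤ x i} = Set.pi univ (fun _ => Ici (0:ℝ)) := by
        ext x; simp [Pi.le_def]
      rw [this]; exact isClosed_set_pi fun i _ => isClosed_Ici
    have hfc : ContinuousOn f {x : Fin r → ℝ | ∀ i, 0 ≤ x i} := by
      rw [hf]
      refine ((qf_cont A).const_mul (1/2)).continuousOn.add (continuousOn_finsetSum _ fun i _ => ?_)
      exact gdil_cont.comp (continuous_apply i).continuousOn fun x hx => hx i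
    have hlb : ∀ x, c / 2 * ‖x‖ ^ 2 ≤ f x := by
      intro x
      have h1 := hq x
      have h2 : 0 ≤ ∑ i, gdil (x i) := Finset.sum_nonneg fun i _ => gdil_nonneg _
      rw [hf]; simp only; linarith
    have htend : Tendsto (fun x : Fin r → ℝ => c / 2 * ‖x‖ ^ 2) (cocompact _) atTop :=
      Tendsto.const_mul_atTop (by positivity)
        ((tendsto_pow_atTop two_ne_zero).comp (tendsto_norm_cocompact_atTop))
    obtain ⟨x, hx, hm⟩ := hfc.exists_isMinOn' hcl (x₀ := 0) (by simp) (by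
      refine Eventually.filter_mono inf_le_left ?_
      filter_upwards [htend.eventually_ge_atTop (f 0)] with y hy
      exact hy.trans (hlb y))
    refine ⟨x, fun i => ?_, fun y hy => hm (fun i => (hy i).le)⟩
    by_contra hi
    have hxi : x i = 0 := le_antisymm (not_lt.1 hi) (hx i)
    refine gdil_steep (1 / 2 * (x ⬝ᵥ A.mulVec (Pi.single i 1) + (Pi.single i 1) ⬝ᵥ A.mulVec x))
      (1 / 2 * qf A (Pi.single i 1)) fun t ht => ?_
    have hmem : x + t • (Pi.single i 1 : Fin r → ℝ) ∈ {x : Fin r → ℝ | ∀ i, 0 ≤ x i} := by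
      intro j
      have := hx j
      by_cases hj : j = i
      · subst hj; simpa using by linarith
      · simpa [hj] using this
    have h1 : f x ≤ f (x + t • (Pi.single i 1 : Fin r → ℝ)) := hm hmem
    rw [hf] at h1
    simp only [qf_single] at h1
    have h2 : ∑ j, gdil ((x + t • (Pi.single i 1 : Fin r → ℝ)) j) - ∑ j, gdil (x j)
        = gdil t - gdil 0 := by
      rw [← Finset.sum_sub_distrib, Finset.sum_eq_single i]
      · simp [hxi]
      · intro j _ hj; simp [hj]
      · simp
    linarith
  refine ⟨hconv, hmin, ?_⟩
  have hdiff : ∀ x : Fin r → ℝ, (∀ i, 0 < x i) → DifferentiableAt ℝ f x := by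
    intro x hx
    rw [hf]
    refine DifferentiableAt.add ?_ (DifferentiableAt.fun_sum fun i _ => ?_)
    · unfold qf; fun_prop
    · exact DifferentiableAt.comp (g := gdil) (f := fun y : Fin r → ℝ => y i) x
        (gdil_diff (x i) (hx i)) (differentiableAt_apply i x)
  obtain ⟨x, hx, hm⟩ := hmin
  refine ⟨x, ⟨hx, IsLocalMin.fderiv_eq_zero ?_⟩, ?_⟩
  · filter_upwards [hSo.mem_nhds hx] with y hy using hm y hy
  · rintro y ⟨hy, hy0⟩
    have hy1 := crit_isMin hconv.convexOn (x := y) hy (hdiff y hy) hy0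
    exact hconv.eq_of_isMinOn (fun z hz => hy1 z hz) (fun z hz => hm z hz) hy hx
end

section
/- Let Γ be a finite-index subgroup of SL(2,ℤ), w ∈ ℤ, and let F be a nonzero modular form of weight w for Γ (holomorphic on the upper half plane, invariant under the weight-w slash action of Γ, and with F slashed by every element of SL(2,ℤ) admitting a convergent Fourier expansion ∑_{j≥0} a_j q^{α_j} in rational powers α₀ < α₁ < ⋯ of q = e^{2πiz}). Then there exist a ∈ π²·ℚ and b ∈ ℂ, b ≠ 0, such that for every N ∈ ℕ, e^{a/ε}·F(iε/(2π)) − b·ε^{−w} = o(ε^N) as ε → 0+. -/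
open Real Asymptotics

/-- The entry `γ i j` of an element of `SL(2, ℤ)`, as a complex number. -/
noncomputable def SLentry (γ : Matrix.SpecialLinearGroup (Fin 2) ℤ) (i j : Fin 2) : ℂ :=
  ((γ : Matrix (Fin 2) (Fin 2) ℤ) i j : ℂ)

lemma tail_bound (α : ℕ → ℝ) (hα : StrictMono α) (a : ℕ → ℂ) (G : ℝ → ℂ)
    (h : ∀ Y : ℝ, 0 < Y → HasSum (fun j => a j * ((Real.exp (-(α j * Y)) : ℝ) : ℂ)) (G Y))
    (k : ℕ) (hk : ∀ j < k, a j = 0) :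
    ∃ C : ℝ, ∀ Y : ℝ, 1 ≤ Y →
      ‖((Real.exp (α k * Y) : ℝ) : ℂ) * G Y - a k‖ ≤
        C * Real.exp (-(α (k + 1) - α k) * Y) := by
  have hs := (h 1 one_pos).summable.norm
  have hs2 := (summable_nat_add_iff (k + 1)).2 hs
  refine ⟨(∑' j, ‖a (j + (k + 1)) * ((Real.exp (-(α (j + (k + 1)) * 1)) : ℝ) : ℂ)‖) *
    Real.exp (α k + (α (k + 1) - α k)), fun Y hY => ?_⟩
  have h1 := (hasSum_nat_add_iff' (k + 1)).2 (h Y (by linarith))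
  rw [Finset.sum_range_succ, Finset.sum_eq_zero (fun j hj => by
    rw [hk j (Finset.mem_range.1 hj), zero_mul]), zero_add] at h1
  have h2 := h1.mul_left ((Real.exp (α k * Y) : ℝ) : ℂ)
  have e1 : ((Real.exp (α k * Y) : ℝ) : ℂ) * ((Real.exp (-(α k * Y)) : ℝ) : ℂ) = 1 := by
    rw [← Complex.ofReal_mul, ← Real.exp_add]; simp
  have e2 : ((Real.exp (α k * Y) : ℝ) : ℂ) *
      (G Y - a k * ((Real.exp (-(α k * Y)) : ℝ) : ℂ)) =
      ((Real.exp (α k * Y) : ℝ) : ℂ) * G Y - a k := by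
    linear_combination (-a k) * e1
  rw [e2] at h2
  have h3 := hs2.hasSum.mul_right
    (Real.exp (α k + (α (k + 1) - α k)) * Real.exp (-(α (k + 1) - α k) * Y))
  rw [mul_assoc]
  rw [← h2.tsum_eq]
  refine tsum_of_norm_bounded h3 (fun j => ?_)
  have hle : α (k + 1) ≤ α (j + (k + 1)) := hα.monotone (by omega)
  simp only [norm_mul, Complex.norm_real, Real.norm_eq_abs, Real.abs_exp]
  rw [mul_left_comm, mul_assoc]
  refine mul_le_mul_of_nonneg_left ?_ (norm_nonneg _)
  rw [← Real.exp_add, ← Real.exp_add, ← Real.exp_add]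
  apply Real.exp_le_exp.2
  nlinarith [mul_nonneg (sub_nonneg.2 hle) (sub_nonneg.2 hY)]

lemma exp_small (w : ℤ) (N : ℕ) (d : ℝ) (hd : 0 < d) :
    (fun ε : ℝ => ε ^ (-w) * Real.exp (-d * ε⁻¹)) =o[nhdsWithin 0 (Set.Ioi 0)]
      (fun ε : ℝ => ε ^ N) := by
  have h := (isLittleO_exp_neg_mul_rpow_atTop hd (-((N : ℝ) + w))).comp_tendsto
    (tendsto_inv_nhdsGT_zero (𝕜 := ℝ))
  have h2 := (isBigO_refl (fun ε : ℝ => ε ^ (-w)) (nhdsWithin 0 (Set.Ioi 0))).mul_isLittleO h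
  refine h2.congr' (Filter.EventuallyEq.rfl) ?_
  filter_upwards [self_mem_nhdsWithin] with ε hε
  have hε : 0 < ε := hε
  simp only [Function.comp]
  rw [Real.inv_rpow hε.le, Real.rpow_neg hε.le, inv_inv, Real.rpow_add hε, Real.rpow_natCast,
    Real.rpow_intCast, zpow_neg]
  have := zpow_ne_zero w hε.ne'
  field_simp

/-- Let `Γ` be a finite-index subgroup of `SL(2, ℤ)` and `F` a nonzero
modular form of weight `w` for `Γ`: holomorphic on the upper half plane, invariant under
the weight-`w` slash action of `Γ`, and such that `F` slashed by any `γ ∈ SL(2, ℤ)` has a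
convergent Fourier expansion `∑_{j ≥ 0} a_j q^{α_j}` in rational powers `α₀ < α₁ < ⋯` of
`q = e^{2πiz}`. Then there are `a ∈ π²ℚ` and `b ∈ ℂ`, `b ≠ 0`, with
`e^{a/ε} F(iε/(2π)) - b ε^{-w} = o(ε^N)` for every `N`, as `ε → 0⁺`. -/
theorem modular_form_asymptotics
    (Γ : Subgroup (Matrix.SpecialLinearGroup (Fin 2) ℤ)) (hΓ : Γ.FiniteIndex)
    (w : ℤ) (F : ℂ → ℂ)
    (hhol : DifferentiableOn ℂ F {z : ℂ | 0 < z.im})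
    (hinv : ∀ γ : Matrix.SpecialLinearGroup (Fin 2) ℤ, γ ∈ Γ → ∀ z : ℂ, 0 < z.im →
      F ((SLentry γ 0 0 * z + SLentry γ 0 1) / (SLentry γ 1 0 * z + SLentry γ 1 1)) =
        (SLentry γ 1 0 * z + SLentry γ 1 1) ^ w * F z)
    (hfourier : ∀ γ : Matrix.SpecialLinearGroup (Fin 2) ℤ,
      ∃ α : ℕ → ℚ, StrictMono α ∧ ∃ a : ℕ → ℂ,
        ∀ z : ℂ, 0 < z.im →
          HasSum (fun j : ℕ => a j * Complex.exp (2 * π * Complex.I * (α j : ℂ) * z))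
            ((SLentry γ 1 0 * z + SLentry γ 1 1) ^ (-w) *
              F ((SLentry γ 0 0 * z + SLentry γ 0 1) /
                  (SLentry γ 1 0 * z + SLentry γ 1 1))))
    (hne : ∃ z : ℂ, 0 < z.im ∧ F z ≠ 0) :
    ∃ a : ℝ, (∃ t : ℚ, a = π ^ 2 * t) ∧ ∃ b : ℂ, b ≠ 0 ∧ ∀ N : ℕ,
      (fun ε : ℝ => Complex.exp ((a / ε : ℝ) : ℂ) * F (Complex.I * ε / (2 * π)) -
          b * (ε : ℂ) ^ (-w))
        =o[nhdsWithin 0 (Set.Ioi 0)] (fun ε : ℝ => ε ^ N) := by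
  obtain ⟨α, hα, c, hc⟩ := hfourier ModularGroup.S
  have s00 : SLentry ModularGroup.S 0 0 = 0 := by simp [SLentry, ModularGroup.S]
  have s01 : SLentry ModularGroup.S 0 1 = -1 := by simp [SLentry, ModularGroup.S]
  have s10 : SLentry ModularGroup.S 1 0 = 1 := by simp [SLentry, ModularGroup.S]
  have s11 : SLentry ModularGroup.S 1 1 = 0 := by simp [SLentry, ModularGroup.S]
  simp only [s00, s01, s10, s11, zero_mul, zero_add, one_mul, add_zero] at hc
  have hex : ∃ j, c j ≠ 0 := by
    by_contra! hcon
    obtain ⟨z, hz, hFz⟩ := hne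
    have hz0 : z ≠ 0 := by rintro rfl; simp at hz
    have him : 0 < (-1 / z).im := by
      have : -1 / z = -z⁻¹ := by ring
      rw [this, Complex.neg_im, Complex.inv_im, neg_div, neg_neg]
      exact div_pos hz (Complex.normSq_pos.2 hz0)
    have h := hc _ him
    simp only [hcon, zero_mul] at h
    have h0 := h.unique hasSum_zero
    have e : -1 / (-1 / z) = z := by field_simp
    rw [e] at h0
    rcases mul_eq_zero.1 h0 with h1 | h1
    · exact zpow_ne_zero _ (div_ne_zero (by norm_num) hz0) h1
    · exact hFz h1
  classical
  set k := Nat.find hex with hkdef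
  have hck : c k ≠ 0 := Nat.find_spec hex
  have hk : ∀ j < k, c j = 0 := fun j hj => not_not.1 (Nat.find_min hex hj)
  have hG : ∀ Y : ℝ, 0 < Y →
      HasSum (fun j => c j * ((Real.exp (-((α j : ℝ) * Y)) : ℝ) : ℂ))
        ((Complex.I * (Y / (2 * π) : ℝ)) ^ (-w) * F (-1 / (Complex.I * (Y / (2 * π) : ℝ)))) := by
    intro Y hY
    have h := hc (Complex.I * (Y / (2 * π) : ℝ)) (by
      rw [Complex.I_mul_im, Complex.ofReal_re]; positivity)
    convert h using 3 with j
    rw [Complex.ofReal_exp]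
    congr 1
    push_cast
    have : (π : ℂ) ≠ 0 := by exact_mod_cast Real.pi_ne_zero
    field_simp
    rw [Complex.I_sq]
    ring
  obtain ⟨C, hC⟩ := tail_bound (fun j => (α j : ℝ)) (fun i j hij => Rat.cast_lt.2 (hα hij))
    c _ hG k hk
  have hpi : (π : ℂ) ≠ 0 := by exact_mod_cast Real.pi_ne_zero
  refine ⟨4 * π ^ 2 * α k, ⟨4 * α k, by push_cast; ring⟩, (2 * π * Complex.I) ^ w * c k,
    mul_ne_zero (zpow_ne_zero _ (by simp [Real.pi_ne_zero])) hck, fun N => ?_⟩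
  have hd : (0 : ℝ) < 4 * π ^ 2 * ((α (k + 1) : ℝ) - α k) := by
    have : (α k : ℝ) < α (k + 1) := by exact_mod_cast hα (Nat.lt_succ_self k)
    have : (0 : ℝ) < (α (k + 1) : ℝ) - α k := by linarith
    positivity
  refine IsBigO.trans_isLittleO ?_ (exp_small w N _ hd)
  refine IsBigO.of_bound (‖(2 * π * Complex.I) ^ w‖ * C) ?_
  filter_upwards [self_mem_nhdsWithin,
    mem_nhdsWithin_of_mem_nhds (Iio_mem_nhds (show (0 : ℝ) < 1 by norm_num))] with ε hε hε1
  have hε : 0 < ε := hε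
  have hε1 : ε < 1 := hε1
  have hεc : (ε : ℂ) ≠ 0 := by exact_mod_cast hε.ne'
  have hY : 1 ≤ 4 * π ^ 2 / ε := by
    rw [le_div_iff₀ hε]; nlinarith [Real.pi_gt_three]
  have hb := hC _ hY
  have e1 : Complex.I * ((4 * π ^ 2 / ε / (2 * π) : ℝ) : ℂ) = 2 * π * Complex.I * (ε : ℂ)⁻¹ := by
    push_cast; field_simp; ring
  have e2 : -1 / (2 * π * Complex.I * (ε : ℂ)⁻¹) = Complex.I * ε / (2 * π) := by
    have := Complex.I_ne_zero
    field_simp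
    rw [Complex.I_sq]
  have e3 : (α k : ℝ) * (4 * π ^ 2 / ε) = 4 * π ^ 2 * α k / ε := by ring
  simp only [e1, e2, e3] at hb
  have hI : (2 * π * Complex.I : ℂ) ^ w ≠ 0 := zpow_ne_zero _ (by simp [Real.pi_ne_zero])
  have hew : (ε : ℂ) ^ w ≠ 0 := zpow_ne_zero _ hεc
  have key : Complex.exp ((4 * π ^ 2 * α k / ε : ℝ) : ℂ) * F (Complex.I * ε / (2 * π)) -
      (2 * π * Complex.I) ^ w * c k * (ε : ℂ) ^ (-w) =
      (2 * π * Complex.I) ^ w * (ε : ℂ) ^ (-w) *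
      (((Real.exp (4 * π ^ 2 * α k / ε) : ℝ) : ℂ) *
        ((2 * π * Complex.I * (ε : ℂ)⁻¹) ^ (-w) * F (Complex.I * ε / (2 * π))) - c k) := by
    rw [Complex.ofReal_exp, mul_zpow (2 * π * Complex.I : ℂ) ((ε : ℂ)⁻¹) (-w), inv_zpow, zpow_neg,
      zpow_neg, inv_inv]
    generalize (2 * π * Complex.I : ℂ) ^ w = A at *
    generalize (ε : ℂ) ^ w = B at *
    field_simp
  rw [key, norm_mul, norm_mul, norm_zpow (ε : ℂ), Complex.norm_real, Real.norm_eq_abs,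
    abs_of_pos hε, Real.norm_eq_abs, abs_of_pos (mul_pos (zpow_pos hε _) (Real.exp_pos _))]
  have e4 : -((α (k + 1) : ℝ) - α k) * (4 * π ^ 2 / ε) =
    -(4 * π ^ 2 * ((α (k + 1) : ℝ) - α k)) * ε⁻¹ := by ring
  rw [e4] at hb
  calc _ ≤ ‖(2 * π * Complex.I : ℂ) ^ w‖ * ε ^ (-w) * _ :=
        mul_le_mul_of_nonneg_left hb (by positivity)
    _ = _ := by ring
end

section
/- Let x, y ∈ ℂ ∖ {0} satisfy y(1 − x⁴) = x³ and x(1 − y⁴) = y³. Then (x/y)⁴ = 1, hence x⁴ = y⁴, and writing Q = x⁴ one has (1 − Q)⁴ = Q². Consequently, every solution of the Nahm system 1 − Q₁ = Q₁^{3/4} Q₂^{−1/4}, 1 − Q₂ = Q₁^{−1/4} Q₂^{3/4} (for the matrix A = (3/4, −1/4; −1/4, 3/4), with Q_i = x⁴ resp. y⁴ and the fourth-root branches x, y) has Q₁ = Q₂ = Q with (1 − Q)⁴ = Q², i.e. (Q² − 3Q + 1)(Q² − Q + 1) = 0. -/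
/-- If nonzero `x, y ∈ ℂ` satisfy `y(1 - x⁴) = x³` and
`x(1 - y⁴) = y³` (the algebraic form of the Nahm system for
`A = (3/4, -1/4; -1/4, 3/4)` with fourth-root branches `x = Q₁^{1/4}`, `y = Q₂^{1/4}`),
then `(x/y)⁴ = 1`, hence `x⁴ = y⁴`, and `Q = x⁴` satisfies `(1 - Q)⁴ = Q²`,
i.e. `(Q² - 3Q + 1)(Q² - Q + 1) = 0`. -/
theorem nahm_system_three_quarters (x y : ℂ) (hx : x ≠ 0) (hy : y ≠ 0)
    (h1 : y * (1 - x ^ 4) = x ^ 3) (h2 : x * (1 - y ^ 4) = y ^ 3) :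
    (x / y) ^ 4 = 1 ∧ x ^ 4 = y ^ 4 ∧ (1 - x ^ 4) ^ 4 = (x ^ 4) ^ 2 ∧
      ((x ^ 4) ^ 2 - 3 * x ^ 4 + 1) * ((x ^ 4) ^ 2 - x ^ 4 + 1) = 0 := by
  have hne : 1 + x * y ≠ 0 := by
    intro h
    apply hy
    linear_combination h1 + x ^ 3 * h
  have h4 : x ^ 4 = y ^ 4 := by
    apply mul_right_cancel₀ hne
    linear_combination y * h2 - x * h1
  have hQ : (1 - x ^ 4) ^ 4 = (x ^ 4) ^ 2 := by
    apply mul_left_cancel₀ (pow_ne_zero 4 hx)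
    have h := congrArg (fun z => z ^ 4) h1
    simp only [mul_pow] at h
    rw [← h4] at h
    linear_combination h
  refine ⟨?_, h4, hQ, ?_⟩
  · rw [div_pow, h4, div_self (pow_ne_zero 4 hy)]
  · linear_combination hQ
end
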